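/- (Flag lemma) Let M be a median algebra and let a, a₁, …, aₙ be pairwise distinct points of M such that for every pair i ≠ j there exists a_{ij} ∈ M making (a, aᵢ, a_{ij}, aⱼ) a median square (four pairwise distinct points with aⱼaaᵢ = a, aaᵢa_{ij} = aᵢ, aᵢa_{ij}aⱼ = a_{ij}, a_{ij}aⱼa = aⱼ). Then there exists an injective median-preserving map f : {0,1}ⁿ → M with f(0,…,0) = a and f(eᵢ) = aᵢ for each i, where eᵢ has 1 in the i-th coordinate and 0 elsewhere; that is, the edges {a,aᵢ} span a median n-cube. -/

import Mathlib

/-- The majority-vote median on `Bool`. -/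
def bmed (x y z : Bool) : Bool := (x && y) || (y && z) || (x && z)

/-- The laws of a median algebra, for a ternary operation `m`. -/
structure IsMedian {M : Type*} (m : M → M → M → M) : Prop where
  maj : ∀ a b : M, m a a b = a
  symm_left : ∀ a b c : M, m a b c = m b a c
  symm_right : ∀ a b c : M, m a b c = m a c b
  distrib : ∀ a b c d e : M, m a b (m c d e) = m (m a b c) (m a b d) e

namespace IsMedian

variable {M : Type*} {m : M → M → M → M}

theorem maj_right (h : IsMedian m) (a b : M) : m a b b = b := by
  rw [h.symm_left, h.symm_right, h.maj]

theorem maj_outer (h : IsMedian m) (a b : M) : m a b a = a := by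
  rw [h.symm_right, h.maj]

theorem assoc (h : IsMedian m) (a x y z : M) : m a (m a x y) z = m a x (m a y z) := by
  rw [h.distrib a x a y z, h.maj_outer]

theorem absorb (h : IsMedian m) {a b x : M} (hx : m a x b = x) (y : M) :
    m a x (m b x y) = x := by
  rw [h.distrib, hx, h.maj_right, h.maj]

theorem median_mem (h : IsMedian m) {a b x y : M} (hx : m a x b = x) (hy : m a y b = y)
    (z : M) : m a (m x y z) b = m x y z := by
  rw [h.symm_right, h.distrib, h.symm_right a b x, hx, h.symm_right a b y, hy]

theorem mem_swap (h : IsMedian m) {a b x : M} (hx : m a x b = x) : m b x a = x := by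
  rw [h.symm_right, h.symm_left, h.symm_right, hx]

/-- Elements lying below at least two of `x`, `y`, `z` lie below their median. -/
theorem le_median (h : IsMedian m) {a p x y : M} (hx : m a p x = p) (hy : m a p y = p) (z : M) :
    m a p (m x y z) = p := by
  rw [h.distrib, hx, hy, h.maj]

theorem rotate (h : IsMedian m) (x y z : M) : m x y z = m y z x := by
  rw [h.symm_left, h.symm_right]

/-- A finite family which is pairwise bounded above, in the order based at `a`, is bounded
above. -/
theorem exists_upper_bound (h : IsMedian m) {ι : Type*} (a : M) (c : ι → M)
    (hc : ∀ i j, ∃ x, m a (c i) x = c i ∧ m a (c j) x = c j) (s : Finset ι) :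
    ∃ b, ∀ i ∈ s, m a (c i) b = c i := by
  classical
  induction s using Finset.strongInduction with
  | H s ih =>
    by_cases hs : 2 < s.card
    · obtain ⟨i, j, k, hi, hj, hk, hij, hik, hjk⟩ := Finset.two_lt_card_iff.mp hs
      obtain ⟨x, hx⟩ := ih _ (Finset.erase_ssubset hi)
      obtain ⟨y, hy⟩ := ih _ (Finset.erase_ssubset hj)
      obtain ⟨z, hz⟩ := ih _ (Finset.erase_ssubset hk)
      refine ⟨m x y z, fun l hl => ?_⟩
      by_cases hli : l = i
      · subst hli
        rw [h.rotate x y z]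
        exact h.le_median (hy l (Finset.mem_erase.2 ⟨hij, hl⟩))
          (hz l (Finset.mem_erase.2 ⟨hik, hl⟩)) x
      have hlx := hx l (Finset.mem_erase.2 ⟨hli, hl⟩)
      by_cases hlj : l = j
      · subst hlj
        rw [h.symm_right x y z]
        exact h.le_median hlx (hz l (Finset.mem_erase.2 ⟨hjk, hl⟩)) y
      · exact h.le_median hlx (hy l (Finset.mem_erase.2 ⟨hlj, hl⟩)) z
    · rcases s.eq_empty_or_nonempty with rfl | ⟨i, hi⟩
      · exact ⟨a, by simp⟩
      · have hcard : (s.erase i).card ≤ 1 := by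
          rw [Finset.card_erase_of_mem hi]; omega
        rcases (s.erase i).eq_empty_or_nonempty with he | ⟨j, hj⟩
        · obtain ⟨x, hx, -⟩ := hc i i
          refine ⟨x, fun l hl => ?_⟩
          by_cases hli : l = i
          · rwa [hli]
          · have : l ∈ s.erase i := Finset.mem_erase.2 ⟨hli, hl⟩
            simp [he] at this
        · obtain ⟨x, hxi, hxj⟩ := hc i j
          refine ⟨x, fun l hl => ?_⟩
          by_cases hli : l = i
          · rwa [hli]
          · rwa [Finset.card_le_one.1 hcard l (Finset.mem_erase.2 ⟨hli, hl⟩) j hj]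

/-- The interval from `a` to `b` is a distributive lattice, with meet `m a` and join `m b`. -/
abbrev intervalDistribLattice (h : IsMedian m) (a b : M) :
    DistribLattice {x : M // m a x b = x} :=
  letI : Max {x : M // m a x b = x} :=
    ⟨fun x y => ⟨m b x y, by rw [h.rotate b x y]; exact h.median_mem x.2 y.2 b⟩⟩
  letI : Min {x : M // m a x b = x} :=
    ⟨fun x y => ⟨m a x y, by rw [h.rotate a x y]; exact h.median_mem x.2 y.2 a⟩⟩
  letI : Lattice {x : M // m a x b = x} := Lattice.mk'
    (fun x y => Subtype.ext (h.symm_right b x y))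
    (fun x y z => Subtype.ext (h.assoc b x y z))
    (fun x y => Subtype.ext (h.symm_right a x y))
    (fun x y z => Subtype.ext (h.assoc a x y z))
    (fun x y => Subtype.ext (h.absorb (h.mem_swap x.2) y))
    (fun x y => Subtype.ext (h.absorb x.2 y))
  DistribLattice.ofInfSupLe fun x y z => le_of_eq <| Subtype.ext <| by
    change m a x (m b y z) = m b (m a x y) (m a x z)
    rw [h.rotate b, h.distrib, ← h.rotate b]

/-- In the interval from `a` to `b`, the median is the lattice median. -/
theorem interval_median (h : IsMedian m) (a b : M) (x y z : {x : M // m a x b = x}) :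
    letI := h.intervalDistribLattice a b
    ((x ⊓ y ⊔ y ⊓ z ⊔ x ⊓ z : {x : M // m a x b = x}) : M) = m x y z := by
  let := h.intervalDistribLattice a b
  let t : {x : M // m a x b = x} := ⟨m x y z, h.median_mem x.2 y.2 z⟩
  have lower : ∀ p q r : {x : M // m a x b = x}, m p q r = t.1 → p ⊓ q ≤ t := by
    intro p q r ht
    refine inf_eq_left.1 (Subtype.ext ?_)
    change m a (m a p q) t.1 = m a p q
    rw [← ht]
    refine h.le_median ?_ ?_ _
    · rw [h.symm_right a p q, h.assoc, h.maj_right]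
    · rw [h.assoc, h.maj_right]
  have upper : ∀ p q r : {x : M // m a x b = x}, m p q r = t.1 → t ≤ p ⊔ q := by
    intro p q r ht
    refine sup_eq_right.1 (Subtype.ext ?_)
    change m b t.1 (m b p q) = m b p q
    rw [← ht, h.symm_right b]
    refine h.le_median ?_ ?_ _
    · rw [h.symm_right b p q, h.assoc, h.maj_right]
    · rw [h.assoc, h.maj_right]
  have hyz : m y z x = t.1 := (h.rotate x y z).symm
  have hxz : m x z y = t.1 := h.symm_right x z y
  suffices x ⊓ y ⊔ y ⊓ z ⊔ x ⊓ z = t from congrArg Subtype.val this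
  refine le_antisymm (sup_le (sup_le (lower x y z rfl) (lower y z x hyz)) (lower x z y hxz)) ?_
  calc t ≤ (x ⊔ y) ⊓ ((y ⊔ z) ⊓ (x ⊔ z)) :=
        le_inf (upper x y z rfl) (le_inf (upper y z x hyz) (upper x z y hxz))
    _ ≤ x ⊓ y ⊔ y ⊓ z ⊔ x ⊓ z := by
      rw [← sup_inf_right, inf_sup_left, inf_sup_right x y z]
      exact sup_le (le_sup_of_le_left (le_sup_of_le_left (inf_le_right.trans (inf_comm y x).le)))
        (sup_le le_sup_right (le_sup_of_le_left le_sup_right))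

end IsMedian

theorem Finset.sup_inter_of_pairwise_disjoint {ι α : Type*} [DecidableEq ι] [DistribLattice α]
    [OrderBot α] {c : ι → α} (hc : Pairwise fun i j => Disjoint (c i) (c j)) (s t : Finset ι) :
    (s ∩ t).sup c = s.sup c ⊓ t.sup c := by
  refine le_antisymm (le_inf (Finset.sup_mono Finset.inter_subset_left)
    (Finset.sup_mono Finset.inter_subset_right)) ?_
  rw [Finset.sup_inf_sup]
  refine Finset.sup_le fun ⟨i, j⟩ hij => ?_
  rw [Finset.mem_product] at hij
  by_cases h : i = j
  · subst h
    exact inf_le_left.trans (Finset.le_sup (f := c) (Finset.mem_inter.2 hij))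
  · exact (hc h).le_bot.trans bot_le

theorem Finset.le_sup_iff_of_pairwise_disjoint {ι α : Type*} [DistribLattice α]
    [OrderBot α] {c : ι → α} (hc : Pairwise fun i j => Disjoint (c i) (c j))
    (hbot : ∀ i, c i ≠ ⊥) {s : Finset ι} {i : ι} : c i ≤ s.sup c ↔ i ∈ s := by
  refine ⟨fun h => ?_, Finset.le_sup⟩
  by_contra hi
  have hd : Disjoint (c i) (s.sup c) :=
    Finset.disjoint_sup_right.2 fun j hj => hc fun hij => hi (hij ▸ hj)
  exact hbot i (hd.eq_bot_of_le h)

/-- Flag lemma: if `a, a₁, …, aₙ` are pairwise distinct and every pair of edges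
`{a,aᵢ}, {a,aⱼ}` spans a median square, then the edges `{a,aᵢ}` span a median
`n`-cube. -/
theorem flag_lemma {M : Type*} (m : M → M → M → M)
    (maj : ∀ a b : M, m a a b = a)
    (symm1 : ∀ a b c : M, m a b c = m b a c)
    (symm2 : ∀ a b c : M, m a b c = m a c b)
    (distrib : ∀ a b c d e : M, m a b (m c d e) = m (m a b c) (m a b d) e)
    (n : ℕ) (a : M) (av : Fin n → M)
    (hinj : Function.Injective av) (hne : ∀ i, av i ≠ a)
    (hsq : ∀ i j : Fin n, i ≠ j → ∃ x : M,
      x ≠ a ∧ x ≠ av i ∧ x ≠ av j ∧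
      m (av j) a (av i) = a ∧ m a (av i) x = av i ∧
      m (av i) x (av j) = x ∧ m x (av j) a = av j) :
    ∃ f : (Fin n → Bool) → M,
      Function.Injective f ∧
      (∀ u v w : Fin n → Bool,
        f (fun i => bmed (u i) (v i) (w i)) = m (f u) (f v) (f w)) ∧
      f (fun _ => false) = a ∧
      (∀ i : Fin n, f (fun j => decide (j = i)) = av i) := by
  classical
  have h : IsMedian m := ⟨maj, symm1, symm2, distrib⟩
  obtain ⟨b, hb⟩ := h.exists_upper_bound a av (fun i j => by
    by_cases hij : i = j
    · exact ⟨av i, h.maj_right a (av i), by rw [← hij, h.maj_right]⟩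
    · obtain ⟨x, -, -, -, -, hi, -, hj⟩ := hsq i j hij
      exact ⟨x, hi, by rw [h.rotate, symm1, hj]⟩) Finset.univ
  let := h.intervalDistribLattice a b
  let : OrderBot {x : M // m a x b = x} :=
    { bot := ⟨a, maj a b⟩
      bot_le := fun x => inf_eq_left.1 (Subtype.ext (maj a x)) }
  let c : Fin n → {x : M // m a x b = x} := fun i => ⟨av i, hb i (Finset.mem_univ i)⟩
  have hdisj : Pairwise fun i j => Disjoint (c i) (c j) := by
    intro i j hij
    obtain ⟨x, -, -, -, hx, -⟩ := hsq i j hij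
    refine disjoint_iff.2 (Subtype.ext ?_)
    change m a (av i) (av j) = a
    rw [← h.rotate, hx]
  have hbot : ∀ i, c i ≠ ⊥ := fun i hi => hne i (congrArg Subtype.val hi)
  let S : (Fin n → Bool) → Finset (Fin n) := fun u => Finset.univ.filter fun i => u i = true
  refine ⟨fun u => ((S u).sup c).1, fun u v huv => ?_, fun u v w => ?_, ?_, fun i => ?_⟩
  · have huv' : (S u).sup c = (S v).sup c := Subtype.ext huv
    funext i
    have hi : i ∈ S u ↔ i ∈ S v := by
      rw [← Finset.le_sup_iff_of_pairwise_disjoint hdisj hbot, huv',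
        Finset.le_sup_iff_of_pairwise_disjoint hdisj hbot]
    simp only [S, Finset.mem_filter_univ] at hi
    exact Bool.eq_iff_iff.2 hi
  · have hS : S (fun i => bmed (u i) (v i) (w i)) = S u ∩ S v ∪ S v ∩ S w ∪ S u ∩ S w := by
      ext i
      simp [S, bmed, or_assoc]
    change ((S _).sup c).1 = _
    rw [← h.interval_median a b, hS, Finset.sup_union, Finset.sup_union,
      Finset.sup_inter_of_pairwise_disjoint hdisj, Finset.sup_inter_of_pairwise_disjoint hdisj,
      Finset.sup_inter_of_pairwise_disjoint hdisj]
  · change ((S _).sup c).1 = a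
    have hS : S (fun _ => false) = ∅ := by simp [S]
    rw [hS, Finset.sup_empty]
    rfl
  · change ((S _).sup c).1 = av i
    have hS : S (fun j => decide (j = i)) = {i} := by
      ext j
      simp [S]
    rw [hS, Finset.sup_singleton]
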